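/- Let B be a finite simple graph on a vertex type V. There exists a binary relation F : V → V → Prop such that for every vertex x there is a vertex y with: x adjacent to y, F x y, ¬ F y x, and (F x x ↔ ¬ F y y) — if, and only if, every connected component of B contains a cycle of even length (i.e., for every vertex v there is a vertex u reachable from v and a closed walk at u that is a cycle of even length). -/

import Mathlib

theorem aux_walk {V : Type*} (B : SimpleGraph V) (f : V → V) (hf : ∀ x, B.Adj x (f x)) (n : ℕ) :
    ∀ x : V, ∃ p : B.Walk x (f^[n] x), p.length = n ∧ ∀ i ≤ n, p.getVert i = f^[i] x := by
  induction n with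
  | zero => 
    intro x
    refine ⟨SimpleGraph.Walk.nil, rfl, ?_⟩
    intro i hi
    obtain rfl : i = 0 := by omega
    rfl
  | succ n ih =>
    intro x
    obtain ⟨p, hp, hg⟩ := ih (f x)
    refine ⟨SimpleGraph.Walk.cons (hf x) p, ?_, ?_⟩
    · simp [hp]
    · intro i hi
      cases i with
      | zero => rfl
      | succ i =>
        exact hg i (by omega)

theorem aux_cycle {V : Type*} (B : SimpleGraph V) (f : V → V) (hf : ∀ x, B.Adj x (f x))
    (u : V) (h3 : 3 ≤ Function.minimalPeriod f u) :
    ∃ p : B.Walk u u, p.IsCycle ∧ p.length = Function.minimalPeriod f u := by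
  obtain ⟨p, hp, hg⟩ := aux_walk B f hf (Function.minimalPeriod f u) u
  have hu : f^[Function.minimalPeriod f u] u = u := Function.iterate_minimalPeriod
  have hinj : ∀ i j, i < Function.minimalPeriod f u → j < Function.minimalPeriod f u →
      f^[i] u = f^[j] u → i = j := fun i j hi hj h =>
    Function.iterate_injOn_Iio_minimalPeriod hi hj h
  generalize Function.minimalPeriod f u = n at *
  obtain ⟨q, hq, hg⟩ : ∃ q : B.Walk u u, q.length = n ∧ ∀ i ≤ n, q.getVert i = f^[i] u :=
    ⟨p.copy rfl hu, by simpa using hp, fun i hi => by simpa using hg i hi⟩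
  refine ⟨q, ?_, hq⟩
  rw [SimpleGraph.Walk.isCycle_iff_isPath_tail_and_le_length]
  refine ⟨?_, by omega⟩
  have hl : q.tail.length + 1 = q.length := SimpleGraph.Walk.length_tail_add_one
    (by rw [SimpleGraph.Walk.not_nil_iff_lt_length]; omega)
  rw [← SimpleGraph.Walk.IsPath.getVert_injOn_iff]
  intro i hi j hj hij
  simp only [Set.mem_setOf_eq] at hi hj
  simp only [SimpleGraph.Walk.getVert_tail] at hij
  rw [hg _ (by omega), hg _ (by omega)] at hij
  have key : ∀ i ≤ n, ∃ k < n, f^[i] u = f^[k] u ∧ (i = k ∨ (i = n ∧ k = 0)) := by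
    intro i hi
    by_cases h : i = n
    · exact ⟨0, by omega, by rw [h, hu]; rfl, Or.inr ⟨h, rfl⟩⟩
    · exact ⟨i, by omega, rfl, Or.inl rfl⟩
  obtain ⟨k, hk, hk1, hk2⟩ := key (i+1) (by omega)
  obtain ⟨l, hl, hl1, hl2⟩ := key (j+1) (by omega)
  have := hinj k l hk hl (by rw [← hk1, ← hl1, hij])
  omega

/-- Partial solution on `S`. -/
def AuxGood {V : Type*} (B : SimpleGraph V) (S : Set V) (f : V → V) (c : V → Bool) : Prop :=
  ∀ x ∈ S, f x ∈ S ∧ B.Adj x (f x) ∧ c (f x) = !c x ∧ f (f x) ≠ x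

open Classical in
theorem AuxGood.union {V : Type*} {B : SimpleGraph V} {S T : Set V} {f g : V → V} {c d : V → Bool}
    (h : AuxGood B S f c) (h' : AuxGood B T g d) (hd : ∀ x ∈ T, x ∉ S) :
    AuxGood B (S ∪ T) (fun x => if x ∈ S then f x else g x)
      (fun x => if x ∈ S then c x else d x) := by
  rintro x (hx | hx)
  · obtain ⟨h1, h2, h3, h4⟩ := h x hx
    simp [hx, h1, h2, h3, h4]
  · obtain ⟨h1, h2, h3, h4⟩ := h' x hx
    simp [hd _ hx, hd _ h1, h1, h2, h3, h4]

open Classical in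
theorem AuxGood.insert {V : Type*} {B : SimpleGraph V} {S : Set V} {f : V → V} {c : V → Bool}
    (h : AuxGood B S f c) {x y : V} (hx : x ∉ S) (hy : y ∈ S) (hxy : B.Adj x y) :
    AuxGood B (insert x S) (fun z => if z ∈ S then f z else y)
      (fun z => if z ∈ S then c z else !c y) := by
  rintro z (rfl | hz)
  · have h1 : f y ≠ z := fun e => hx (e ▸ (h y hy).1)
    simp [hx, hy, hxy, h1]
  · obtain ⟨h1, h2, h3, h4⟩ := h z hz
    simp [hz, h1, h2, h3, h4]

theorem aux_good_cycle {V : Type*} {B : SimpleGraph V} {u : V} (p : B.Walk u u) (hp : p.IsCycle)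
    (he : Even p.length) : ∃ f c, AuxGood B {x | x ∈ p.support} f c := by
  classical
  have h3 := hp.three_le_length
  have hidx : ∀ x, ∃ i, x ∈ p.support → i < p.length ∧ p.getVert i = x := by
    intro x
    by_cases hx : x ∈ p.support
    · obtain ⟨n, hn, hl⟩ := SimpleGraph.Walk.mem_support_iff_exists_getVert.1 hx
      by_cases h : n = p.length
      · refine ⟨0, fun _ => ⟨by omega, ?_⟩⟩
        rw [← hn, h]; simp
      · exact ⟨n, fun _ => ⟨by omega, hn⟩⟩
    · exact ⟨0, fun h => absurd h hx⟩
  choose idx hidx using hidx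
  have hinj : ∀ i j, i < p.length → j < p.length → p.getVert i = p.getVert j → i = j := 
    fun i j hi hj h => hp.getVert_injOn' (show i ≤ _ by omega) (show j ≤ _ by omega) h
  have hI : ∀ i, i < p.length → idx (p.getVert i) = i := fun i hi => by
    obtain ⟨h1, h2⟩ := hidx _ (p.getVert_mem_support i)
    exact hinj _ _ h1 hi h2
  have hlast : p.getVert p.length = p.getVert 0 := by simp
  have hS : ∀ i, i < p.length → (i + 1 < p.length ∧ idx (p.getVert (i+1)) = i + 1) ∨
      (i + 1 = p.length ∧ idx (p.getVert (i+1)) = 0) := by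
    intro i hi
    by_cases h : i + 1 = p.length
    · right; refine ⟨h, ?_⟩
      rw [h, hlast]; exact hI 0 (by omega)
    · left; exact ⟨by omega, hI _ (by omega)⟩
  refine ⟨fun x => p.getVert (idx x + 1), fun x => decide (Even (idx x)), ?_⟩
  intro x hx
  obtain ⟨h1, h2⟩ := hidx x hx
  refine ⟨p.getVert_mem_support _, ?_, ?_, ?_⟩
  · have := p.adj_getVert_succ h1
    rwa [h2] at this
  · show decide (Even (idx (p.getVert (idx x + 1)))) = !decide (Even (idx x))
    rcases hS _ h1 with ⟨h, e⟩ | ⟨h, e⟩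
    · rw [e]; simp only [Nat.even_add_one, decide_not]
    · rw [e]; rw [← h, Nat.even_add_one] at he; simp [he]
  · show p.getVert (idx (p.getVert (idx x + 1)) + 1) ≠ x
    intro e
    have e' := congrArg idx e
    have hlt : idx (p.getVert (idx x + 1)) < p.length := (hidx _ (p.getVert_mem_support _)).1
    have a := hS _ h1
    have b := hS _ hlt
    omega

theorem aux_closed {V : Type*} {B : SimpleGraph V} {S : Set V}
    (h : ∀ x y, x ∉ S → B.Adj x y → y ∉ S) {a b : V} (p : B.Walk a b) (ha : a ∉ S) :
    ∀ x ∈ p.support, x ∉ S := by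
  induction p with
  | nil => simpa using ha
  | cons hadj p ih =>
    intro x hx
    rw [SimpleGraph.Walk.support_cons, List.mem_cons] at hx
    rcases hx with rfl | hx
    · exact ha
    · exact ih (h _ _ ha hadj) x hx

theorem aux_exists {V : Type*} [Fintype V] (B : SimpleGraph V)
    (H : ∀ v : V, ∃ u : V, B.Reachable v u ∧ ∃ p : B.Walk u u, p.IsCycle ∧ Even p.length) :
    ∃ f c, AuxGood B Set.univ f c := by
  classical
  obtain ⟨S, hS⟩ := (Set.toFinite {S : Set V | ∃ f c, AuxGood B S f c}).exists_maximal
    ⟨∅, id, fun _ => true, fun x hx => absurd hx (Set.notMem_empty x)⟩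
  obtain ⟨f, c, hfc⟩ := hS.prop
  suffices S = Set.univ by subst this; exact ⟨f, c, hfc⟩
  by_contra hne
  obtain ⟨v, hv⟩ := (Set.ne_univ_iff_exists_notMem S).1 hne
  by_cases hcl : ∀ x y, x ∉ S → B.Adj x y → y ∉ S
  · obtain ⟨u, ⟨q⟩, p, hp, he⟩ := H v
    have hu : u ∉ S := aux_closed hcl q hv u q.end_mem_support
    obtain ⟨g, d, hgd⟩ := aux_good_cycle p hp he
    have := hS.le_of_ge ⟨_, _, hfc.union hgd (aux_closed hcl p hu)⟩ Set.subset_union_left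
    exact hu (this (Or.inr p.start_mem_support))
  · push Not at hcl
    obtain ⟨x, y, hx, hxy, hy⟩ := hcl
    have := hS.le_of_ge ⟨_, _, hfc.insert hx hy hxy⟩ (Set.subset_insert _ _)
    exact hx (this (Set.mem_insert _ _))

/-- A finite simple graph `B` admits a binary relation `F` such
that every vertex `x` has a neighbor `y` with `F x y`, `¬ F y x`, and
`F x x ↔ ¬ F y y` iff every connected component of `B` contains a cycle of
even length. -/
theorem stmt_1 {V : Type*} [Fintype V] (B : SimpleGraph V) :
    (∃ F : V → V → Prop, ∀ x : V, ∃ y : V,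
      B.Adj x y ∧ F x y ∧ ¬ F y x ∧ (F x x ↔ ¬ F y y)) ↔
    (∀ v : V, ∃ u : V, B.Reachable v u ∧
      ∃ p : B.Walk u u, p.IsCycle ∧ Even p.length) := by
  constructor
  · rintro ⟨F, hF⟩ v
    choose f hadj h1 h2 h3 using hF
    obtain ⟨m, n, hmn, he⟩ := Finite.exists_ne_map_eq_of_infinite (fun n : ℕ => f^[n] v)
    wlog hlt : m < n generalizing m n
    · exact this n m hmn.symm he.symm (by omega)
    have hper : Function.IsPeriodicPt f (n - m) (f^[m] v) := by
      show f^[n-m] (f^[m] v) = f^[m] v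
      rw [← Function.iterate_add_apply, he]
      congr 2; omega
    have hpos := hper.minimalPeriod_pos (by omega)
    refine ⟨f^[m] v, ?_, ?_⟩
    · obtain ⟨p, -⟩ := aux_walk B f hadj m v
      exact ⟨p⟩
    generalize f^[m] v = u at *
    have hcol : ∀ k, (F (f^[k] u) (f^[k] u) ↔ (F u u ↔ Even k)) := by
      intro k
      induction k with
      | zero => simp
      | succ k ih =>
        rw [Function.iterate_succ_apply', Nat.even_add_one]
        have := h3 (f^[k] u)
        tauto
    have hu : f^[Function.minimalPeriod f u] u = u := Function.iterate_minimalPeriod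
    have hev : Even (Function.minimalPeriod f u) := by
      have := hcol (Function.minimalPeriod f u)
      rw [hu] at this
      tauto
    have hne2 : Function.minimalPeriod f u ≠ 2 := by
      intro h
      rw [h] at hu
      have hu' : f (f u) = u := hu
      have a := h1 (f u)
      rw [hu'] at a
      exact h2 u a
    obtain ⟨p, hp, hl⟩ := aux_cycle B f hadj u (by obtain ⟨k, hk⟩ := hev; omega)
    exact ⟨p, hp, hl ▸ hev⟩
  · intro H
    obtain ⟨f, c, h⟩ := aux_exists B H
    refine ⟨fun x y => (x = y ∧ c x = true) ∨ (x ≠ y ∧ f x = y), fun x => ⟨f x, ?_⟩⟩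
    obtain ⟨-, h1, h2, h3⟩ := h x trivial
    refine ⟨h1, Or.inr ⟨h1.ne, rfl⟩, ?_, ?_⟩
    · rintro (⟨e, -⟩ | ⟨-, e⟩)
      · exact h1.ne e.symm
      · exact h3 e
    · simp [h2]
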